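/- arXiv:2101.02618 — 2 statements merged into one kernel-verified Lean document; each statement's English description precedes it below -/
import Mathlib

section
/- Let M ∈ ℝ^{2n×2n} be symmetric positive-definite and let S ∈ Sp(2n) satisfy SᵀMS = diag(D, D) with D = diag(d₁, ..., dₙ) and d₁ ≤ ... ≤ dₙ, dⱼ > 0. Then a matrix T ∈ Sp(2n) satisfies TᵀMT = diag(D, D) if and only if there exists an orthosymplectic matrix K ∈ OrSp(2n) that commutes with diag(D, D) (i.e., K·diag(D,D) = diag(D,D)·K, which is exactly the condition that all four n×n blocks of K are block diagonal conforming to the multiplicities of the distinct symplectic eigenvalues) such that T = SK. -/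
open Matrix

noncomputable section

/-- Index type for `2n`-dimensional objects: first copy for indices `1..n`,
second copy for indices `n+1..2n`. -/
abbrev Idx (n : ℕ) := Fin n ⊕ Fin n

/-- The Poisson matrix `J_{2n} = [[0, I], [-I, 0]]`. -/
def Jmat (n : ℕ) : Matrix (Idx n) (Idx n) ℝ := fromBlocks 0 1 (-1) 0

/-- `X ∈ Sp(2k, 2n)`, i.e. `Xᵀ J_{2n} X = J_{2k}`. -/
def Symplectic {n k : ℕ} (X : Matrix (Idx n) (Idx k) ℝ) : Prop :=
  Xᵀ * Jmat n * X = Jmat k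

/-- `K ∈ OrSp(2n)`, i.e. `KᵀK = I` and `Kᵀ J K = J`. -/
def OrthoSymplectic {n : ℕ} (K : Matrix (Idx n) (Idx n) ℝ) : Prop :=
  Kᵀ * K = 1 ∧ Symplectic K

/-- The block-diagonal matrix `diag(D, D)` with `D = diagonal d`. -/
def diagPair {n : ℕ} (d : Fin n → ℝ) : Matrix (Idx n) (Idx n) ℝ :=
  fromBlocks (diagonal d) 0 0 (diagonal d)

/-- The matrix `[[0, -Λ], [Λ, 0]]` with `Λ = diagonal lam`. -/
def offPair {k : ℕ} (lam : Fin k → ℝ) : Matrix (Idx k) (Idx k) ℝ :=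
  fromBlocks 0 (-(diagonal lam)) (diagonal lam) 0

theorem Jmat_mul_Jmat (n : ℕ) : Jmat n * Jmat n = -1 := by
  simp [Jmat, fromBlocks_multiply, ← fromBlocks_one, fromBlocks_neg]

theorem diagPair_eq_diagonal {n : ℕ} (d : Fin n → ℝ) :
    diagPair d = diagonal (Sum.elim d d) := by
  simp [diagPair, fromBlocks_diagonal]

theorem Jmat_mul_diagPair {n : ℕ} (d : Fin n → ℝ) :
    Jmat n * diagPair d = diagPair d * Jmat n := by
  simp only [Jmat, diagPair, fromBlocks_multiply]
  simp

/-- A square symplectic matrix has left inverse `-J Xᵀ J`. -/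
theorem Symplectic.left_inverse {n : ℕ} {X : Matrix (Idx n) (Idx n) ℝ} (hX : Symplectic X) :
    -(Jmat n * Xᵀ * Jmat n) * X = 1 := by
  have h : Xᵀ * Jmat n * X = Jmat n := hX
  rw [neg_mul, Matrix.mul_assoc, Matrix.mul_assoc, ← Matrix.mul_assoc Xᵀ, h, Jmat_mul_Jmat, neg_neg]

/-- A matrix commuting with the square of a positive diagonal matrix commutes with the
diagonal matrix itself. -/
theorem commute_diagonal_of_commute_sq {ι : Type*} [Fintype ι] [DecidableEq ι] {e : ι → ℝ}
    (he : ∀ i, 0 < e i) {K : Matrix ι ι ℝ}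
    (h : K * (diagonal e * diagonal e) = diagonal e * diagonal e * K) :
    K * diagonal e = diagonal e * K := by
  ext i j
  have hij := congrFun (congrFun h i) j
  rw [diagonal_mul_diagonal, mul_diagonal, diagonal_mul] at hij
  rw [mul_diagonal, diagonal_mul]
  have hpos : e i + e j ≠ 0 := (add_pos (he i) (he j)).ne'
  apply mul_left_cancel₀ hpos
  linear_combination hij

/-- A symplectic matrix preserving `diag(D, D)` by congruence commutes with it. -/
theorem Symplectic.commute_diagPair {n : ℕ} {K : Matrix (Idx n) (Idx n) ℝ} (hK : Symplectic K)
    {d : Fin n → ℝ} (hd : ∀ j, 0 < d j) (h : Kᵀ * diagPair d * K = diagPair d) :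
    K * diagPair d = diagPair d * K := by
  have hinv := mul_eq_one_comm.mp hK.left_inverse
  have hJJ := Jmat_mul_Jmat n
  have hcomm := Jmat_mul_diagPair d
  have hA : K * (Jmat n * diagPair d) = Jmat n * diagPair d * K := by
    calc K * (Jmat n * diagPair d)
        = K * Jmat n * (Kᵀ * diagPair d * K) := by rw [h, Matrix.mul_assoc]
      _ = K * -(Jmat n * Kᵀ * (Jmat n * Jmat n)) * diagPair d * K := by
          rw [hJJ]; simp [Matrix.mul_assoc]
      _ = K * -(Jmat n * Kᵀ * Jmat n) * (Jmat n * diagPair d * K) := by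
          simp only [Matrix.mul_assoc, neg_mul, mul_neg]
      _ = Jmat n * diagPair d * K := by rw [hinv, Matrix.one_mul]
  have hsq : Jmat n * diagPair d * (Jmat n * diagPair d) = -(diagPair d * diagPair d) := by
    rw [hcomm, Matrix.mul_assoc, ← Matrix.mul_assoc (Jmat n), hcomm, Matrix.mul_assoc, hJJ]
    simp
  have hK2 : K * (diagPair d * diagPair d) = diagPair d * diagPair d * K := by
    rw [← neg_inj, ← Matrix.mul_neg, ← Matrix.neg_mul (diagPair d * diagPair d), ← hsq, ← Matrix.mul_assoc, hA,
      Matrix.mul_assoc, hA, ← Matrix.mul_assoc]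
  rw [diagPair_eq_diagonal] at hK2 ⊢
  exact commute_diagonal_of_commute_sq (by rintro (j | j) <;> exact hd j) hK2

/-- A matrix with `KᵀDK = D` that commutes with the positive `D = diag(D, D)` is orthogonal. -/
theorem transpose_mul_self_of_commute_diagPair {n : ℕ} {K : Matrix (Idx n) (Idx n) ℝ}
    {d : Fin n → ℝ} (hd : ∀ j, 0 < d j) (h : Kᵀ * diagPair d * K = diagPair d)
    (hc : K * diagPair d = diagPair d * K) : Kᵀ * K = 1 := by
  have hunit : IsUnit (diagPair d) := by
    rw [diagPair_eq_diagonal, isUnit_diagonal, Pi.isUnit_iff]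
    rintro (j | j) <;> exact (hd j).ne'.isUnit
  apply hunit.mul_right_cancel
  rw [Matrix.mul_assoc, hc, ← Matrix.mul_assoc, h, Matrix.one_mul]

/-- characterization of all symplectically diagonalizing matrices of `M`:
`T` symplectically diagonalizes `M` iff `T = SK` with `K` orthosymplectic and
commuting with `diag(D,D)`. -/
theorem diagonalizing_matrices_characterization {n : ℕ}
    (M S : Matrix (Idx n) (Idx n) ℝ) (hM : M.PosDef) (hS : Symplectic S)
    (d : Fin n → ℝ) (hd : ∀ j, 0 < d j) (hmono : Monotone d)
    (hdiag : Sᵀ * M * S = diagPair d)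
    (T : Matrix (Idx n) (Idx n) ℝ) (hT : Symplectic T) :
    Tᵀ * M * T = diagPair d ↔
      ∃ K : Matrix (Idx n) (Idx n) ℝ,
        OrthoSymplectic K ∧ K * diagPair d = diagPair d * K ∧ T = S * K := by
  constructor
  · intro hTM
    have hinv := mul_eq_one_comm.mp hS.left_inverse
    obtain ⟨K, rfl⟩ : ∃ K, T = S * K :=
      ⟨-(Jmat n * Sᵀ * Jmat n) * T, by rw [← Matrix.mul_assoc, hinv, Matrix.one_mul]⟩
    have hK : Symplectic K := by
      have hS' : Sᵀ * Jmat n * S = Jmat n := hS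
      have hT' : (S * K)ᵀ * Jmat n * (S * K) = Jmat n := hT
      change Kᵀ * Jmat n * K = Jmat n
      calc Kᵀ * Jmat n * K = (S * K)ᵀ * Jmat n * (S * K) := by
            conv_lhs => rw [← hS']
            simp only [transpose_mul, Matrix.mul_assoc]
        _ = Jmat n := hT'
    have h : Kᵀ * diagPair d * K = diagPair d := by
      calc Kᵀ * diagPair d * K = (S * K)ᵀ * M * (S * K) := by
            rw [← hdiag]
            simp only [transpose_mul, Matrix.mul_assoc]
        _ = diagPair d := hTM
    have hc := hK.commute_diagPair hd h
    exact ⟨K, ⟨transpose_mul_self_of_commute_diagPair hd h hc, hK⟩, hc, rfl⟩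
  · rintro ⟨K, ⟨hKK, -⟩, hc, rfl⟩
    calc (S * K)ᵀ * M * (S * K) = Kᵀ * (Sᵀ * M * S) * K := by
          simp only [transpose_mul, Matrix.mul_assoc]
      _ = diagPair d := by
          rw [hdiag, Matrix.mul_assoc, ← hc, ← Matrix.mul_assoc, hKK, Matrix.one_mul]
end
end

section
/- Let M ∈ ℝ^{2n×2n} be symmetric positive-definite. A matrix X* ∈ Sp(2k,2n) is a critical point of the trace minimization problem (i.e., there exists a skew-symmetric L* ∈ ℝ^{2k×2k} with MX* = J_{2n}X*L*) if and only if there exist an orthosymplectic K ∈ OrSp(2k) and a diagonal matrix Λ = diag(λ₁, ..., λ_k) such that M(X*K) = J_{2n}(X*K)·[[0, −Λ], [Λ, 0]], i.e., the columns of X*K form a normalized symplectic eigenvector set of M. -/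
open Matrix

noncomputable section

/-- The real `2n × 2n` matrix `[[re C, -im C], [im C, re C]]` of a complex matrix `C`. -/
def realRep {n : ℕ} (C : Matrix (Fin n) (Fin n) ℂ) : Matrix (Idx n) (Idx n) ℝ :=
  fromBlocks (C.map Complex.re) (-(C.map Complex.im)) (C.map Complex.im) (C.map Complex.re)

theorem realRep_mul {n : ℕ} (C D : Matrix (Fin n) (Fin n) ℂ) :
    realRep (C * D) = realRep C * realRep D := by
  simp only [realRep, fromBlocks_multiply, fromBlocks_inj]
  refine ⟨?_, ?_, ?_, ?_⟩ <;> ext i j <;>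
    simp [mul_apply, Finset.sum_add_distrib, sub_eq_add_neg, add_comm]

theorem realRep_conjTranspose {n : ℕ} (C : Matrix (Fin n) (Fin n) ℂ) :
    realRep Cᴴ = (realRep C)ᵀ := by
  simp only [realRep, fromBlocks_transpose, fromBlocks_inj]
  refine ⟨?_, ?_, ?_, ?_⟩ <;> ext i j <;> simp

theorem realRep_one {n : ℕ} : realRep (1 : Matrix (Fin n) (Fin n) ℂ) = 1 := by
  rw [realRep, ← fromBlocks_one, fromBlocks_inj]
  refine ⟨?_, ?_, ?_, ?_⟩ <;> ext i j <;> by_cases h : i = j <;> simp [one_apply, h]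

theorem realRep_neg_I {n : ℕ} :
    realRep ((-Complex.I) • (1 : Matrix (Fin n) (Fin n) ℂ)) = Jmat n := by
  rw [realRep, Jmat, fromBlocks_inj]
  refine ⟨?_, ?_, ?_, ?_⟩ <;> ext i j <;> by_cases h : i = j <;> simp [one_apply, h]

theorem realRep_I_smul_diagonal {n : ℕ} (d : Fin n → ℝ) :
    realRep (Complex.I • diagonal (fun i => (d i : ℂ))) = offPair d := by
  rw [realRep, offPair, fromBlocks_inj]
  refine ⟨?_, ?_, ?_, ?_⟩ <;> ext i j <;> by_cases h : i = j <;> simp [h]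

theorem orthoSymplectic_realRep {n : ℕ} {U : Matrix (Fin n) (Fin n) ℂ} (hU : Uᴴ * U = 1) :
    OrthoSymplectic (realRep U) := by
  refine ⟨?_, ?_⟩
  · rw [← realRep_conjTranspose, ← realRep_mul, hU, realRep_one]
  · rw [Symplectic, ← realRep_conjTranspose, ← realRep_neg_I, ← realRep_mul, ← realRep_mul]
    simp [hU]

theorem exists_realRep_of_commute {n : ℕ} {L : Matrix (Idx n) (Idx n) ℝ}
    (h : L * Jmat n = Jmat n * L) : ∃ C, realRep C = L := by
  refine ⟨of fun i j => ⟨L (.inl i) (.inl j), L (.inr i) (.inl j)⟩, ?_⟩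
  rw [← fromBlocks_toBlocks L] at h
  simp only [Jmat, fromBlocks_multiply, fromBlocks_inj] at h
  obtain ⟨h₁, h₂, -, -⟩ := h
  simp only [Matrix.mul_zero, Matrix.mul_one, Matrix.mul_neg, Matrix.zero_mul, Matrix.one_mul,
    zero_add, add_zero] at h₁ h₂
  ext (i | i) (j | j)
  · simp [realRep]
  · have := congrFun₂ h₁ i j
    simp [toBlocks₁₂, toBlocks₂₁] at this
    simp [realRep, ← this]
  · simp [realRep]
  · have := congrFun₂ h₂ i j
    simpa [realRep, toBlocks₁₁, toBlocks₂₂] using this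

theorem realRep_injective {n : ℕ} :
    Function.Injective (realRep : Matrix (Fin n) (Fin n) ℂ → Matrix (Idx n) (Idx n) ℝ) := by
  intro C D h
  simp only [realRep, fromBlocks_inj] at h
  ext i j
  exact Complex.ext (congrFun₂ h.1 i j) (congrFun₂ h.2.2.1 i j)

theorem realRep_neg {n : ℕ} (C : Matrix (Fin n) (Fin n) ℂ) : realRep (-C) = -realRep C := by
  simp only [realRep, fromBlocks_neg, fromBlocks_inj]
  refine ⟨?_, ?_, ?_, ?_⟩ <;> ext i j <;> simp

/-- A skew-symmetric matrix commuting with `J` is orthosymplectically similar to some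
`[[0, -Λ], [Λ, 0]]`. -/
theorem exists_orthoSymplectic_mul_eq {n : ℕ} {L : Matrix (Idx n) (Idx n) ℝ}
    (hL : Lᵀ = -L) (h : L * Jmat n = Jmat n * L) :
    ∃ (K : Matrix (Idx n) (Idx n) ℝ) (lam : Fin n → ℝ),
      OrthoSymplectic K ∧ L * K = K * offPair lam := by
  obtain ⟨C, rfl⟩ := exists_realRep_of_commute h
  have hC : Cᴴ = -C := realRep_injective (by rw [realRep_conjTranspose, realRep_neg, hL])
  have hH : ((-Complex.I) • C).IsHermitian := by
    simp [IsHermitian, conjTranspose_smul, hC]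
  set U : Matrix (Fin n) (Fin n) ℂ := (hH.eigenvectorUnitary).1
  have hU : Uᴴ * U = 1 := Unitary.coe_star_mul_self hH.eigenvectorUnitary
  refine ⟨realRep U, hH.eigenvalues, orthoSymplectic_realRep hU, ?_⟩
  have hs : (-Complex.I) • C = U * diagonal (fun i => (hH.eigenvalues i : ℂ)) * Uᴴ := by
    have := hH.spectral_theorem
    rw [Unitary.conjStarAlgAut_apply] at this
    exact this
  have hCU : C * U = U * (Complex.I • diagonal (fun i => (hH.eigenvalues i : ℂ))) := by
    have hCI : C = Complex.I • ((-Complex.I) • C) := by simp [smul_smul]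
    have hDU := congrArg (fun A => Complex.I • (A * U)) hs
    simp only [Matrix.mul_assoc, hU, Matrix.mul_one] at hDU
    rw [Matrix.mul_smul, ← hDU, Matrix.smul_mul, smul_smul]
    simp
  rw [← realRep_mul, hCU, realRep_mul, realRep_I_smul_diagonal]

theorem offPair_transpose {n : ℕ} (d : Fin n → ℝ) : (offPair d)ᵀ = -offPair d := by
  simp [offPair, fromBlocks_transpose, fromBlocks_neg]

theorem Jmat_transpose (n : ℕ) : (Jmat n)ᵀ = -Jmat n := by
  simp [Jmat, fromBlocks_transpose, fromBlocks_neg]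

/-- `X*` is a critical point of the trace minimization problem iff
there are `K ∈ OrSp(2k)` and `Λ = diag(λ₁,…,λ_k)` such that the columns of
`X*K` form a normalized symplectic eigenvector set of `M`:
`M(X*K) = J(X*K)·[[0,−Λ],[Λ,0]]`. -/
theorem critical_point_characterization {n k : ℕ} (hk : k ≤ n)
    (M : Matrix (Idx n) (Idx n) ℝ) (hM : M.PosDef)
    (X : Matrix (Idx n) (Idx k) ℝ) (hX : Symplectic X) :
    (∃ L : Matrix (Idx k) (Idx k) ℝ, Lᵀ = -L ∧ M * X = Jmat n * X * L) ↔
      ∃ (K : Matrix (Idx k) (Idx k) ℝ) (lam : Fin k → ℝ),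
        OrthoSymplectic K ∧ M * (X * K) = Jmat n * (X * K) * offPair lam := by
  constructor
  · rintro ⟨L, hL, hML⟩
    have hS : Xᵀ * M * X = Jmat k * L := by
      rw [Matrix.mul_assoc, hML, ← hX, Matrix.mul_assoc, Matrix.mul_assoc, Matrix.mul_assoc]
    have hMt : Mᵀ = M := by simpa using hM.isHermitian.eq
    have hcomm : L * Jmat k = Jmat k * L := by
      have ht := congrArg transpose hS
      simp only [transpose_mul, transpose_transpose, hMt, hL, Jmat_transpose,
        Matrix.neg_mul, Matrix.mul_neg, neg_neg] at ht
      rw [← ht, ← hS, Matrix.mul_assoc]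
    obtain ⟨K, lam, hK, hLK⟩ := exists_orthoSymplectic_mul_eq hL hcomm
    refine ⟨K, lam, hK, ?_⟩
    rw [← Matrix.mul_assoc, hML, Matrix.mul_assoc, hLK]
    simp only [Matrix.mul_assoc]
  · rintro ⟨K, lam, ⟨hK, -⟩, h⟩
    have hK' : K * Kᵀ = 1 := mul_eq_one_comm.mp hK
    refine ⟨K * offPair lam * Kᵀ, ?_, ?_⟩
    · simp [transpose_mul, offPair_transpose, Matrix.mul_assoc]
    · have := congrArg (· * Kᵀ) h
      simp only [Matrix.mul_assoc, hK', Matrix.mul_one] at this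
      simpa only [Matrix.mul_assoc] using this
end
end
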